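/- arXiv:2305.00707 — 2 statements merged into one kernel-verified Lean document; each statement's English description precedes it below -/
import Mathlib

section
/- Let 𝔛 = (X, {A_i}_{i=0}^n) and 𝔜 = (Y, {A'_j}_{j=0}^m) be P-polynomial association schemes. Then the composition of 𝔛 and 𝔜 — the association scheme on X × Y whose adjacency matrices are A_{i0} := A_i ⊗ J_Y for 1 ≤ i ≤ n and A_{0j} := I_X ⊗ A'_j for 0 ≤ j ≤ m — is a bivariate P-polynomial association scheme on the domain D := {(i,0) : 1 ≤ i ≤ n} ∪ {(0,j) : 0 ≤ j ≤ m} ⊆ ℕ² with respect to the lexicographic order ≤_lex. -/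
open scoped BigOperators
open Matrix

noncomputable section

/-- The all-ones matrix `J`. -/
def matJ (X : Type*) : Matrix X X ℂ := Matrix.of fun _ _ => 1

/-- A family of matrices `A : ι → Matrix X X ℂ` forms a commutative association scheme:
0-1 matrices summing to `J`, containing the identity, closed under transpose, whose
pairwise products are linear combinations of the family and commute. -/
structure IsAssocScheme {X ι : Type*} [Fintype X] [DecidableEq X] [Fintype ι]
    (A : ι → Matrix X X ℂ) : Prop where
  entries_zero_one : ∀ (i : ι) (x y : X), A i x y = 0 ∨ A i x y = 1
  sum_eq_J : ∑ i, A i = matJ X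
  exists_id : ∃ i₀, A i₀ = 1
  exists_transpose : ∀ i, ∃ i', (A i)ᵀ = A i'
  mul_eq_lin : ∀ i j, ∃ p : ι → ℂ, A i * A j = ∑ k, p k • A k
  mul_comm' : ∀ i j, A i * A j = A j * A i

/-- A monomial order on `ℕ^ℓ`: a total well-ordering compatible with addition. -/
structure MonOrder (ℓ : ℕ) where
  le : (Fin ℓ → ℕ) → (Fin ℓ → ℕ) → Prop
  le_refl : ∀ a, le a a
  le_trans : ∀ a b c, le a b → le b c → le a c
  le_antisymm : ∀ a b, le a b → le b a → a = b
  le_total : ∀ a b, le a b ∨ le b a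
  wf : WellFounded fun a b => le a b ∧ a ≠ b
  add_compat : ∀ a b c, le a b → le (a + c) (b + c)

/-- The `i`-th standard unit vector of `ℕ^ℓ`. -/
def epsV {ℓ : ℕ} (i : Fin ℓ) : Fin ℓ → ℕ := Pi.single i 1

/-- Conversion from `Fin ℓ → ℕ` to exponents of `MvPolynomial`. -/
def toExp {ℓ : ℕ} (α : Fin ℓ → ℕ) : Fin ℓ →₀ ℕ := Finsupp.equivFunOnFinite.symm α

/-- `α` is the multidegree of `f` with respect to the monomial order `mo`. -/
def IsMultideg {ℓ : ℕ} (mo : MonOrder ℓ) (f : MvPolynomial (Fin ℓ) ℂ) (α : Fin ℓ → ℕ) : Prop :=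
  MvPolynomial.coeff (toExp α) f ≠ 0 ∧ ∀ d ∈ f.support, mo.le (⇑d) α

/-- The ordered monomial `M 1 ^ α 1 * ⋯ * M ℓ ^ α ℓ`. -/
def mpow {X : Type*} [Fintype X] [DecidableEq X] {ℓ : ℕ}
    (M : Fin ℓ → Matrix X X ℂ) (α : Fin ℓ → ℕ) : Matrix X X ℂ :=
  ((List.finRange ℓ).map fun i => M i ^ α i).prod

/-- Evaluation of a multivariate polynomial at a family of matrices. -/
def matEval {X : Type*} [Fintype X] [DecidableEq X] {ℓ : ℕ}
    (f : MvPolynomial (Fin ℓ) ℂ) (M : Fin ℓ → Matrix X X ℂ) : Matrix X X ℂ :=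
  ∑ d ∈ f.support, MvPolynomial.coeff d f • mpow M (⇑d)

/-- `ℓ`-variate `P`-polynomial association scheme on the domain `D` with respect to the
monomial order `mo`, with adjacency matrices (relabeled) `A α` for `α ∈ D`. -/
structure IsMultiPPoly {X : Type*} [Fintype X] [DecidableEq X] {ℓ : ℕ}
    (D : Finset (Fin ℓ → ℕ)) (mo : MonOrder ℓ)
    (A : (Fin ℓ → ℕ) → Matrix X X ℂ) : Prop where
  scheme : IsAssocScheme fun α : {a // a ∈ D} => A α.1
  eps_mem : ∀ i : Fin ℓ, epsV i ∈ D
  lower_closed : ∀ α ∈ D, ∀ β : Fin ℓ → ℕ, (∀ i, β i ≤ α i) → β ∈ D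
  exists_poly : ∀ α ∈ D, ∃ v : MvPolynomial (Fin ℓ) ℂ,
    A α = matEval v (fun i => A (epsV i)) ∧ IsMultideg mo v α ∧
      ∀ d ∈ v.support, ⇑d ∈ D
  recur : ∀ i : Fin ℓ, ∀ α ∈ D, ∃ c : (Fin ℓ → ℕ) → ℂ,
    (A (epsV i) * mpow (fun j => A (epsV j)) α
        = ∑ β ∈ D, c β • mpow (fun j => A (epsV j)) β) ∧
      ∀ β ∈ D, c β ≠ 0 → mo.le β (α + epsV i)

/-- The Hadamard (entrywise) monomial `E 1 ^{∘ α 1} ∘ ⋯ ∘ E ℓ ^{∘ α ℓ}`. -/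
def hpow {X : Type*} {ℓ : ℕ} (E : Fin ℓ → Matrix X X ℂ) (α : Fin ℓ → ℕ) : Matrix X X ℂ :=
  Matrix.of fun x y => ∏ i, (E i x y) ^ α i

/-- Evaluation of a multivariate polynomial at a family of matrices under the
Hadamard product. -/
def hEval {X : Type*} {ℓ : ℕ}
    (f : MvPolynomial (Fin ℓ) ℂ) (E : Fin ℓ → Matrix X X ℂ) : Matrix X X ℂ :=
  ∑ d ∈ f.support, MvPolynomial.coeff d f • hpow E (⇑d)

/-- `E` is the family of primitive idempotents of the Bose–Mesner algebra spanned by `A`. -/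
structure IsPrimIdem {X ι κ : Type*} [Fintype X] [DecidableEq X] [Fintype ι] [Fintype κ]
    (A : ι → Matrix X X ℂ) (E : κ → Matrix X X ℂ) : Prop where
  idem : ∀ j, E j * E j = E j
  orth : ∀ j k, j ≠ k → E j * E k = 0
  sum_eq_one : ∑ j, E j = 1
  span_eq : Submodule.span ℂ (Set.range E) = Submodule.span ℂ (Set.range A)

/-- `ℓ`-variate `Q`-polynomial association scheme on the domain `D` with respect to the
monomial order `mo`; `A` are the adjacency matrices and `E α` for `α ∈ D` the (relabeled)
primitive idempotents. -/
structure IsMultiQPoly {X ι : Type*} [Fintype X] [DecidableEq X] [Fintype ι] {ℓ : ℕ}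
    (D : Finset (Fin ℓ → ℕ)) (mo : MonOrder ℓ)
    (A : ι → Matrix X X ℂ) (E : (Fin ℓ → ℕ) → Matrix X X ℂ) : Prop where
  scheme : IsAssocScheme A
  primIdem : IsPrimIdem A fun α : {a // a ∈ D} => E α.1
  eps_mem : ∀ i : Fin ℓ, epsV i ∈ D
  lower_closed : ∀ α ∈ D, ∀ β : Fin ℓ → ℕ, (∀ i, β i ≤ α i) → β ∈ D
  exists_poly : ∀ α ∈ D, ∃ v : MvPolynomial (Fin ℓ) ℂ,
    (Fintype.card X : ℂ) • E α
        = hEval v (fun i => (Fintype.card X : ℂ) • E (epsV i)) ∧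
      IsMultideg mo v α ∧ ∀ d ∈ v.support, ⇑d ∈ D
  recur : ∀ i : Fin ℓ, ∀ α ∈ D, ∃ c : (Fin ℓ → ℕ) → ℂ,
    (Matrix.hadamard (E (epsV i)) (hpow (fun j => E (epsV j)) α)
        = ∑ β ∈ D, c β • hpow (fun j => E (epsV j)) β) ∧
      ∀ β ∈ D, c β ≠ 0 → mo.le β (α + epsV i)

/-- The graded lexicographic order on `ℕ^ℓ`. -/
def grlexLe {ℓ : ℕ} (a b : Fin ℓ → ℕ) : Prop :=
  (∑ i, a i) < (∑ i, b i) ∨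
    ((∑ i, a i) = (∑ i, b i) ∧
      (a = b ∨ ∃ i, (∀ j, j < i → a j = b j) ∧ a i < b i))

/-- The lexicographic order on `ℕ^ℓ`. -/
def lexLe {ℓ : ℕ} (a b : Fin ℓ → ℕ) : Prop :=
  a = b ∨ ∃ i, (∀ j, j < i → a j = b j) ∧ a i < b i

/-- Evaluation of a univariate polynomial at a matrix under the Hadamard product. -/
def hEval1 {X : Type*} (v : Polynomial ℂ) (M : Matrix X X ℂ) : Matrix X X ℂ :=
  ∑ n ∈ v.support, v.coeff n • Matrix.of fun x y => (M x y) ^ n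

end

section Composition

variable {X Y : Type*} [Fintype X] [DecidableEq X] [Fintype Y] [DecidableEq Y]

/-- The adjacency matrices of the composition of two association schemes:
`A_{i0} = A_i ⊗ J_Y` for `i ≥ 1` and `A_{0j} = I_X ⊗ A'_j`. -/
def compA (A : ℕ → Matrix X X ℂ) (A' : ℕ → Matrix Y Y ℂ) :
    (Fin 2 → ℕ) → Matrix (X × Y) (X × Y) ℂ :=
  fun α => Matrix.of fun p q =>
    if α 0 = 0 then (if p.1 = q.1 then A' (α 1) p.2 q.2 else 0)
    else A (α 0) p.1 q.1

/-- The primitive idempotents of the composition of two association schemes: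
`E_{j0} = I_X ⊗ E'_j` for `j ≥ 1` and `E_{0i} = E_i ⊗ E'_0`. -/
def compE (E : ℕ → Matrix X X ℂ) (E' : ℕ → Matrix Y Y ℂ) :
    (Fin 2 → ℕ) → Matrix (X × Y) (X × Y) ℂ :=
  fun α => Matrix.of fun p q =>
    if α 0 = 0 then E (α 1) p.1 q.1 * E' 0 p.2 q.2
    else (if p.1 = q.1 then (1 : ℂ) else 0) * E' (α 0) p.2 q.2

/-- The domain `D = {(i,0) : 1 ≤ i ≤ n} ∪ {(0,j) : 0 ≤ j ≤ m}` of the composition. -/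
def compD (n m : ℕ) : Finset (Fin 2 → ℕ) :=
  ((Finset.Icc 1 n).image fun i => (![i, 0] : Fin 2 → ℕ)) ∪
    ((Finset.range (m + 1)).image fun j => (![0, j] : Fin 2 → ℕ))

end Composition

open scoped Kronecker

section Helpers

theorem mem_compD {n m : ℕ} {α : Fin 2 → ℕ} :
    α ∈ compD n m ↔ (1 ≤ α 0 ∧ α 0 ≤ n ∧ α 1 = 0) ∨ (α 0 = 0 ∧ α 1 ≤ m) := by
  simp only [compD, Finset.mem_union, Finset.mem_image, Finset.mem_Icc, Finset.mem_range]
  constructor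
  · rintro (⟨i, hi, rfl⟩ | ⟨j, hj, rfl⟩)
    · left; simp; omega
    · right; simp; omega
  · rintro (⟨h1, h2, h3⟩ | ⟨h1, h2⟩)
    · exact Or.inl ⟨α 0, ⟨h1, h2⟩, by ext i; fin_cases i <;> simp [h3]⟩
    · exact Or.inr ⟨α 1, by omega, by ext i; fin_cases i <;> simp [h1]⟩

theorem exists_of_mem_compD {n m : ℕ} {α : Fin 2 → ℕ} (h : α ∈ compD n m) :
    (∃ i, 1 ≤ i ∧ i ≤ n ∧ α = ![i, 0]) ∨ ∃ j ≤ m, α = ![0, j] := by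
  rcases mem_compD.1 h with ⟨h1, h2, h3⟩ | ⟨h1, h2⟩
  · exact Or.inl ⟨α 0, h1, h2, by ext i; fin_cases i <;> simp [h3]⟩
  · exact Or.inr ⟨α 1, h2, by ext i; fin_cases i <;> simp [h1]⟩

theorem lexLe_two_iff {a b : Fin 2 → ℕ} :
    lexLe a b ↔ a 0 < b 0 ∨ (a 0 = b 0 ∧ a 1 ≤ b 1) := by
  simp only [lexLe, Fin.exists_fin_two, Fin.forall_fin_two, funext_iff]
  simp
  omega

theorem epsV_zero_two : (epsV 0 : Fin 2 → ℕ) = ![1, 0] := by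
  ext i; fin_cases i <;> simp [epsV]

theorem epsV_one_two : (epsV 1 : Fin 2 → ℕ) = ![0, 1] := by
  ext i; fin_cases i <;> simp [epsV]

theorem leadingCoeff_ne_zero_of_degree_eq {v : Polynomial ℂ} {d : ℕ} (h : v.degree = d) :
    v.leadingCoeff ≠ 0 := by
  rw [Polynomial.leadingCoeff_ne_zero]
  rintro rfl
  exact WithBot.coe_ne_bot (h.symm.trans Polynomial.degree_zero)

variable {X Y : Type*}

theorem compA_fst [DecidableEq X] (A : ℕ → Matrix X X ℂ) (A' : ℕ → Matrix Y Y ℂ) {i : ℕ}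
    (hi : 1 ≤ i) (j : ℕ) :
    compA A A' ![i, j] = A i ⊗ₖ matJ Y := by
  ext p q
  have : i ≠ 0 := by omega
  simp [compA, matJ, this]

theorem compA_snd [DecidableEq X] (A : ℕ → Matrix X X ℂ) (A' : ℕ → Matrix Y Y ℂ) (j : ℕ) :
    compA A A' ![0, j] = (1 : Matrix X X ℂ) ⊗ₖ A' j := by
  ext p q
  simp [compA, Matrix.one_apply]

/-- Kronecker multiplication by a fixed right factor, as a linear map. -/
def kronRight (N : Matrix Y Y ℂ) : Matrix X X ℂ →ₗ[ℂ] Matrix (X × Y) (X × Y) ℂ where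
  toFun M := M ⊗ₖ N
  map_add' _ _ := Matrix.add_kronecker _ _ _
  map_smul' _ _ := Matrix.smul_kronecker _ _ _

/-- Kronecker multiplication by a fixed left factor, as a linear map. -/
def kronLeft (M : Matrix X X ℂ) : Matrix Y Y ℂ →ₗ[ℂ] Matrix (X × Y) (X × Y) ℂ where
  toFun N := M ⊗ₖ N
  map_add' _ _ := Matrix.kronecker_add _ _ _
  map_smul' _ _ := Matrix.kronecker_smul _ _ _

@[simp] theorem kronRight_apply (M : Matrix X X ℂ) (N : Matrix Y Y ℂ) :
    kronRight N M = M ⊗ₖ N := rfl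

@[simp] theorem kronLeft_apply (M : Matrix X X ℂ) (N : Matrix Y Y ℂ) :
    kronLeft M N = M ⊗ₖ N := rfl

theorem matJ_mul_self (Y : Type*) [Fintype Y] :
    ∃ c : ℂ, c ≠ 0 ∧ matJ Y * matJ Y = c • matJ Y := by
  rcases isEmpty_or_nonempty Y with hY | hY
  · exact ⟨1, one_ne_zero, Subsingleton.elim _ _⟩
  · refine ⟨Fintype.card Y, by simp, ?_⟩
    ext x y
    simp [matJ, Matrix.mul_apply]

theorem matJ_transpose (Y : Type*) : (matJ Y)ᵀ = matJ Y := rfl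

theorem exists_smul_matJ_of_commute [Fintype Y] {M : Matrix Y Y ℂ} (h : M * matJ Y = matJ Y * M) :
    ∃ c : ℂ, M * matJ Y = c • matJ Y := by
  rcases isEmpty_or_nonempty Y with hY | ⟨⟨y₀⟩⟩
  · exact ⟨0, Subsingleton.elim _ _⟩
  · refine ⟨(matJ Y * M) y₀ y₀, ?_⟩
    ext x y
    have h1 : (M * matJ Y) x y = (M * matJ Y) x y₀ := by simp [matJ, Matrix.mul_apply]
    have h2 : (matJ Y * M) x y₀ = (matJ Y * M) y₀ y₀ := by simp [matJ, Matrix.mul_apply]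
    rw [h1, h, h2]
    simp [matJ]

variable [Fintype X] [DecidableEq X] [Fintype Y] [DecidableEq Y]

theorem mpow_two (M : Fin 2 → Matrix X X ℂ) (a b : ℕ) :
    mpow M ![a, b] = M 0 ^ a * M 1 ^ b := by
  simp [mpow, List.finRange_succ]

theorem one_kronecker_pow (M : Matrix Y Y ℂ) (k : ℕ) :
    ((1 : Matrix X X ℂ) ⊗ₖ M) ^ k = 1 ⊗ₖ (M ^ k) := by
  induction k with
  | zero => simp
  | succ k ih => rw [pow_succ, ih, ← Matrix.mul_kronecker_mul, mul_one, pow_succ]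

theorem kronecker_pow_succ_of_mul_self (M : Matrix X X ℂ) {E : Matrix Y Y ℂ} {c : ℂ}
    (h : E * E = c • E) (k : ℕ) :
    (M ⊗ₖ E) ^ (k + 1) = c ^ k • ((M ^ (k + 1)) ⊗ₖ E) := by
  induction k with
  | zero => simp
  | succ k ih =>
    rw [pow_succ, ih, Matrix.smul_mul, ← Matrix.mul_kronecker_mul, h, Matrix.kronecker_smul,
      smul_smul, ← pow_succ, ← pow_succ]

theorem IsAssocScheme.commute_matJ {ι : Type*} [Fintype ι] {A : ι → Matrix Y Y ℂ}
    (h : IsAssocScheme A) (i : ι) : A i * matJ Y = matJ Y * A i := by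
  rw [← h.sum_eq_J, Finset.mul_sum, Finset.sum_mul]
  exact Finset.sum_congr rfl fun j _ => h.mul_comm' i j

theorem aeval_mem_of_pow_mem {R : Type*} [Ring R] [Algebra ℂ R] (S : Submodule ℂ R) {B : R}
    {d : ℕ} (h : ∀ k ≤ d, B ^ k ∈ S) {p : Polynomial ℂ} (hp : p.natDegree ≤ d) :
    Polynomial.aeval B p ∈ S := by
  rw [Polynomial.aeval_eq_sum_range]
  exact S.sum_mem fun k hk => S.smul_mem _ (h k (by rw [Finset.mem_range] at hk; omega))

section PPolynomial

variable {n : ℕ} {A : ℕ → Matrix X X ℂ}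

theorem mem_of_pow_mem
    (hP : ∀ i ≤ n, ∃ v : Polynomial ℂ, v.degree = (i : ℕ) ∧ A i = Polynomial.aeval (A 1) v)
    (S : Submodule ℂ (Matrix X X ℂ)) (h : ∀ k ≤ n, A 1 ^ k ∈ S) {i : ℕ} (hi : i ≤ n) :
    A i ∈ S := by
  obtain ⟨v, hv, hAv⟩ := hP i hi
  rw [hAv]
  refine aeval_mem_of_pow_mem S h ?_
  rw [Polynomial.natDegree_eq_of_degree_eq_some hv]
  exact hi

theorem pow_mem_of_pow_le_mem (hn : 1 ≤ n) (hs : IsAssocScheme fun i : Fin (n + 1) => A i)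
    (h0 : A 0 = 1)
    (hP : ∀ i ≤ n, ∃ v : Polynomial ℂ, v.degree = (i : ℕ) ∧ A i = Polynomial.aeval (A 1) v)
    (S : Submodule ℂ (Matrix X X ℂ)) (h : ∀ k ≤ n, A 1 ^ k ∈ S) (k : ℕ) : A 1 ^ k ∈ S := by
  have hTS : Submodule.span ℂ (Set.range fun i : Fin (n + 1) => A i) ≤ S := by
    rw [Submodule.span_le]
    rintro _ ⟨i, rfl⟩
    exact mem_of_pow_mem hP S h (Nat.lt_succ_iff.1 i.2)
  refine hTS ?_
  induction k with
  | zero => exact Submodule.subset_span ⟨0, by simp [h0]⟩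
  | succ k ih =>
    have : Submodule.span ℂ (Set.range fun i : Fin (n + 1) => A i) ≤
        (Submodule.span ℂ (Set.range fun i : Fin (n + 1) => A i)).comap
          (LinearMap.mulRight ℂ (A 1)) := by
      rw [Submodule.span_le]
      rintro _ ⟨i, rfl⟩
      obtain ⟨p, hp⟩ := hs.mul_eq_lin i ⟨1, by omega⟩
      simp only [SetLike.mem_coe, Submodule.mem_comap, LinearMap.mulRight_apply]
      simp only at hp
      rw [hp]
      exact Submodule.sum_mem _ fun j _ =>
        Submodule.smul_mem _ _ (Submodule.subset_span ⟨j, rfl⟩)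
    have h1 := this ih
    rwa [Submodule.mem_comap, LinearMap.mulRight_apply, ← pow_succ] at h1

end PPolynomial

theorem exists_coeff_of_mem_span {ι V : Type*} [AddCommGroup V] [Module ℂ V]
    (D : Finset ι) (P : ι → Prop) (f : ι → V) {x : V}
    (hx : x ∈ Submodule.span ℂ (f '' {β | β ∈ D ∧ P β})) :
    ∃ c : ι → ℂ, x = ∑ β ∈ D, c β • f β ∧ ∀ β, c β ≠ 0 → P β := by
  induction hx using Submodule.span_induction with
  | mem x hx =>
    classical
    obtain ⟨β, ⟨hβ, hP⟩, rfl⟩ := hx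
    refine ⟨Pi.single β 1, ?_, ?_⟩
    · rw [Finset.sum_eq_single_of_mem β hβ] <;> simp +contextual
    · intro γ hγ
      by_contra h
      have : γ ≠ β := fun e => h (e ▸ hP)
      simp [this] at hγ
  | zero => exact ⟨0, by simp, by simp⟩
  | add x y _ _ hx hy =>
    obtain ⟨c, rfl, hc⟩ := hx
    obtain ⟨d, rfl, hd⟩ := hy
    refine ⟨c + d, by simp [add_smul, Finset.sum_add_distrib], fun β h => ?_⟩
    by_cases h1 : c β = 0
    · exact hd β (by simpa [h1] using h)
    · exact hc β h1
  | smul a x _ hx =>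
    obtain ⟨c, rfl, hc⟩ := hx
    exact ⟨a • c, by simp [Finset.smul_sum, smul_smul],
      fun β h => hc β (by simp at h; exact h.2)⟩

theorem toExp_coe {ℓ : ℕ} (d : Fin ℓ →₀ ℕ) : toExp (⇑d) = d := by
  ext i; simp [toExp]

theorem coe_toExp {ℓ : ℕ} (α : Fin ℓ → ℕ) : ⇑(toExp α) = α := by
  ext i; simp [toExp]

/-- A linear combination of ordered monomials with exponents in `D` and leading exponent `α`
is the value of a polynomial of multidegree `α`. -/
theorem exists_poly_of_coeff {ℓ : ℕ} (D : Finset (Fin ℓ → ℕ)) (mo : MonOrder ℓ)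
    (M : Fin ℓ → Matrix X X ℂ) {α : Fin ℓ → ℕ} (hα : α ∈ D) {Z : Matrix X X ℂ}
    (c : (Fin ℓ → ℕ) → ℂ) (hZ : Z = ∑ β ∈ D, c β • mpow M β) (hcα : c α ≠ 0)
    (hc : ∀ β, c β ≠ 0 → mo.le β α) :
    ∃ v : MvPolynomial (Fin ℓ) ℂ,
      Z = matEval v M ∧ IsMultideg mo v α ∧ ∀ d ∈ v.support, ⇑d ∈ D := by
  classical
  let v : MvPolynomial (Fin ℓ) ℂ := ∑ β ∈ D, MvPolynomial.monomial (toExp β) (c β)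
  have hv : ∀ d : Fin ℓ →₀ ℕ, v.coeff d = if ⇑d ∈ D then c d else 0 := by
    intro d
    have h1 : ∀ β, (toExp β = d) ↔ ⇑d = β := fun β =>
      ⟨fun h => by rw [← h, coe_toExp], fun h => by rw [← h, toExp_coe]⟩
    simp only [v, MvPolynomial.coeff_sum, MvPolynomial.coeff_monomial, h1, Finset.sum_ite_eq]
  have hsupp : ∀ d ∈ v.support, ⇑d ∈ D ∧ c d ≠ 0 := by
    intro d hd
    rw [MvPolynomial.mem_support_iff, hv] at hd
    by_cases h : ⇑d ∈ D
    · simpa [h] using hd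
    · simp [h] at hd
  refine ⟨v, ?_, ⟨?_, fun d hd => hc _ (hsupp d hd).2⟩, fun d hd => (hsupp d hd).1⟩
  · have hsub : v.support ⊆ D.image toExp := fun d hd =>
      Finset.mem_image.2 ⟨_, (hsupp d hd).1, toExp_coe d⟩
    rw [hZ, matEval, Finset.sum_subset hsub]
    · rw [Finset.sum_image fun a _ b _ h => by rw [← coe_toExp a, h, coe_toExp]]
      refine Finset.sum_congr rfl fun β hβ => ?_
      rw [hv, coe_toExp, if_pos hβ]
    · intro d _ hd
      rw [MvPolynomial.notMem_support_iff.1 hd, zero_smul]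
  · rw [hv, coe_toExp, if_pos hα]
    exact hcα

theorem exists_poly_of_mem_span {ℓ : ℕ} (D : Finset (Fin ℓ → ℕ)) (mo : MonOrder ℓ)
    (M : Fin ℓ → Matrix X X ℂ) {α : Fin ℓ → ℕ} (hα : α ∈ D) {Z : Matrix X X ℂ}
    {a : ℂ} (ha : a ≠ 0)
    (hZ : Z - a • mpow M α ∈
      Submodule.span ℂ (mpow M '' {β | β ∈ D ∧ mo.le β α ∧ β ≠ α})) :
    ∃ v : MvPolynomial (Fin ℓ) ℂ,
      Z = matEval v M ∧ IsMultideg mo v α ∧ ∀ d ∈ v.support, ⇑d ∈ D := by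
  classical
  obtain ⟨c, hZc, hc⟩ := exists_coeff_of_mem_span _ _ _ hZ
  have hcα : c α = 0 := by
    by_contra h
    exact (hc α h).2 rfl
  refine exists_poly_of_coeff D mo M hα (c + Pi.single α a) ?_ (by simpa [hcα] using ha) ?_
  · rw [sub_eq_iff_eq_add.1 hZc]
    simp only [Pi.add_apply, add_smul, Finset.sum_add_distrib]
    congr 1
    rw [Finset.sum_eq_single_of_mem α hα] <;> simp +contextual
  · intro β hβ
    by_cases h : β = α
    · rw [h]; exact mo.le_refl α
    · exact (hc β (by simpa [h] using hβ)).1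

theorem aeval_sub_leading_mem {R : Type*} [Ring R] [Algebra ℂ R] (S : Submodule ℂ R) {B : R}
    {d : ℕ} (h : ∀ k < d, B ^ k ∈ S) {p : Polynomial ℂ} (hp : p.natDegree = d) :
    Polynomial.aeval B p - p.leadingCoeff • B ^ d ∈ S := by
  rw [Polynomial.aeval_eq_sum_range, Finset.sum_range_succ, Polynomial.leadingCoeff, hp,
    add_sub_cancel_right]
  exact S.sum_mem fun k hk => S.smul_mem _ (h k (Finset.mem_range.1 hk))

theorem composition_isAssocScheme {n m : ℕ}
    {A : ℕ → Matrix X X ℂ} {A' : ℕ → Matrix Y Y ℂ}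
    (hXscheme : IsAssocScheme fun i : Fin (n + 1) => A i)
    (hYscheme : IsAssocScheme fun j : Fin (m + 1) => A' j)
    (hA0 : A 0 = 1) (hA'0 : A' 0 = 1)
    (hXsym : ∀ i ≤ n, (A i)ᵀ = A i) (hYsym : ∀ j ≤ m, (A' j)ᵀ = A' j) :
    IsAssocScheme fun α : {a // a ∈ compD n m} => compA A A' α.1 := by
  have hYJ : ∑ j ∈ Finset.range (m + 1), A' j = matJ Y := by
    rw [← hYscheme.sum_eq_J, Finset.sum_range]
  have hXJ : ∑ i ∈ Finset.range (n + 1), A i = matJ X := by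
    rw [← hXscheme.sum_eq_J, Finset.sum_range]
  have hXmul : ∀ i ≤ n, ∀ j ≤ n, ∃ p : Fin (n + 1) → ℂ, A i * A j = ∑ k, p k • A k :=
    fun i hi j hj => hXscheme.mul_eq_lin ⟨i, by omega⟩ ⟨j, by omega⟩
  have hYmul : ∀ i ≤ m, ∀ j ≤ m, ∃ p : Fin (m + 1) → ℂ, A' i * A' j = ∑ k, p k • A' k :=
    fun i hi j hj => hYscheme.mul_eq_lin ⟨i, by omega⟩ ⟨j, by omega⟩
  have hXcomm : ∀ i ≤ n, ∀ j ≤ n, A i * A j = A j * A i :=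
    fun i hi j hj => hXscheme.mul_comm' ⟨i, by omega⟩ ⟨j, by omega⟩
  have hYcomm : ∀ i ≤ m, ∀ j ≤ m, A' i * A' j = A' j * A' i :=
    fun i hi j hj => hYscheme.mul_comm' ⟨i, by omega⟩ ⟨j, by omega⟩
  have hJcomm : ∀ j ≤ m, A' j * matJ Y = matJ Y * A' j :=
    fun j hj => hYscheme.commute_matJ ⟨j, by omega⟩
  obtain ⟨N, -, hN⟩ := matJ_mul_self Y
  have hcomm : ∀ α ∈ compD n m, ∀ β ∈ compD n m,
      compA A A' α * compA A A' β = compA A A' β * compA A A' α := by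
    intro α hα β hβ
    rcases exists_of_mem_compD hα with ⟨i, hi, hin, rfl⟩ | ⟨i, him, rfl⟩ <;>
    rcases exists_of_mem_compD hβ with ⟨j, hj, hjn, rfl⟩ | ⟨j, hjm, rfl⟩
    · rw [compA_fst A A' hi, compA_fst A A' hj, ← Matrix.mul_kronecker_mul,
        ← Matrix.mul_kronecker_mul, hXcomm i hin j hjn]
    · rw [compA_fst A A' hi, compA_snd, ← Matrix.mul_kronecker_mul, ← Matrix.mul_kronecker_mul,
        hJcomm j hjm, one_mul, mul_one]
    · rw [compA_fst A A' hj, compA_snd, ← Matrix.mul_kronecker_mul, ← Matrix.mul_kronecker_mul,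
        hJcomm i him, one_mul, mul_one]
    · rw [compA_snd, compA_snd, ← Matrix.mul_kronecker_mul, ← Matrix.mul_kronecker_mul,
        hYcomm i him j hjm]
  have hT2 : ∀ j ≤ m, (1 : Matrix X X ℂ) ⊗ₖ A' j ∈
      Submodule.span ℂ (Set.range fun α : {a // a ∈ compD n m} => compA A A' α.1) :=
    fun j hj => Submodule.subset_span
      ⟨⟨![0, j], mem_compD.2 (by simp [hj])⟩, compA_snd A A' j⟩
  have hT1 : ∀ i ≤ n, A i ⊗ₖ matJ Y ∈
      Submodule.span ℂ (Set.range fun α : {a // a ∈ compD n m} => compA A A' α.1) := by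
    intro i hi
    rcases Nat.eq_zero_or_pos i with rfl | h0
    · rw [hA0, ← kronLeft_apply, ← hYJ, map_sum]
      exact Submodule.sum_mem _ fun j hj => hT2 j (by rw [Finset.mem_range] at hj; omega)
    · exact Submodule.subset_span
        ⟨⟨![i, 0], mem_compD.2 (by simp; omega)⟩, compA_fst A A' h0 0⟩
  refine ⟨?_, ?_, ⟨⟨![0, 0], mem_compD.2 (by simp)⟩, ?_⟩, ?_, ?_, ?_⟩
  · rintro ⟨α, hα⟩ p q
    rcases exists_of_mem_compD hα with ⟨i, hi, hin, rfl⟩ | ⟨j, hjm, rfl⟩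
    · simp only [compA_fst, hi]
      simpa [matJ] using hXscheme.entries_zero_one ⟨i, by omega⟩ p.1 q.1
    · simp only [compA_snd, Matrix.kroneckerMap_apply, Matrix.one_apply]
      split_ifs
      · simpa using hYscheme.entries_zero_one ⟨j, by omega⟩ p.2 q.2
      · simp
  · rw [Finset.sum_coe_sort (compD n m) (compA A A'), compD, Finset.sum_union, Finset.sum_image,
      Finset.sum_image]
    · have h1 : ∑ i ∈ Finset.Icc 1 n, compA A A' ![i, 0] =
          kronRight (matJ Y) (∑ i ∈ Finset.Icc 1 n, A i) := by
        rw [map_sum]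
        exact Finset.sum_congr rfl fun i hi => compA_fst A A' (Finset.mem_Icc.1 hi).1 0
      have h2 : ∑ j ∈ Finset.range (m + 1), compA A A' ![0, j] =
          kronRight (matJ Y) (A 0) := by
        rw [kronRight_apply, hA0, ← kronLeft_apply, ← hYJ, map_sum]
        exact Finset.sum_congr rfl fun j _ => compA_snd A A' j
      have h3 : A 0 + ∑ i ∈ Finset.Icc 1 n, A i = matJ X := by
        rw [← hXJ, Finset.range_eq_Ico, Finset.sum_eq_sum_Ico_succ_bot (Nat.succ_pos n)]
        rfl
      rw [h1, h2, ← map_add, add_comm, h3]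
      ext p q
      simp [matJ]
    · intro a _ b _ h
      simpa using congrFun h 1
    · intro a _ b _ h
      simpa using congrFun h 0
    · rw [Finset.disjoint_left]
      simp only [Finset.mem_image, Finset.mem_Icc, not_exists, not_and]
      rintro _ ⟨i, hi, rfl⟩ j _ h
      have := congrFun h 0
      simp at this
      omega
  · simp [compA_snd, hA'0]
  · rintro ⟨α, hα⟩
    refine ⟨⟨α, hα⟩, ?_⟩
    rcases exists_of_mem_compD hα with ⟨i, hi, hin, rfl⟩ | ⟨j, hjm, rfl⟩
    · simp only [compA_fst, hi]
      rw [← Matrix.kroneckerMap_transpose, hXsym i hin, matJ_transpose]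
    · simp only [compA_snd]
      rw [← Matrix.kroneckerMap_transpose, hYsym j hjm, Matrix.transpose_one]
  · have key : ∀ α ∈ compD n m, ∀ β ∈ compD n m, compA A A' α * compA A A' β ∈
        Submodule.span ℂ (Set.range fun α : {a // a ∈ compD n m} => compA A A' α.1) := by
      intro α hα β hβ
      have hmix : ∀ i, 1 ≤ i → i ≤ n → ∀ j ≤ m,
          compA A A' ![i, 0] * compA A A' ![0, j] ∈ Submodule.span ℂ
            (Set.range fun α : {a // a ∈ compD n m} => compA A A' α.1) := by
        intro i hi hin j hj
        obtain ⟨c, hc⟩ := exists_smul_matJ_of_commute (hJcomm j hj)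
        rw [compA_fst A A' hi, compA_snd, ← Matrix.mul_kronecker_mul, mul_one, ← hJcomm j hj,
          hc, Matrix.kronecker_smul]
        exact Submodule.smul_mem _ _ (hT1 i hin)
      rcases exists_of_mem_compD hα with ⟨i, hi, hin, rfl⟩ | ⟨i, him, rfl⟩ <;>
      rcases exists_of_mem_compD hβ with ⟨j, hj, hjn, rfl⟩ | ⟨j, hjm, rfl⟩
      · obtain ⟨p, hp⟩ := hXmul i hin j hjn
        rw [compA_fst A A' hi, compA_fst A A' hj, ← Matrix.mul_kronecker_mul, hN,
          Matrix.kronecker_smul, hp, ← kronRight_apply, map_sum]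
        refine Submodule.smul_mem _ _ (Submodule.sum_mem _ fun k _ => ?_)
        rw [map_smul]
        exact Submodule.smul_mem _ _ (hT1 k (by omega))
      · exact hmix i hi hin j hjm
      · rw [hcomm _ hα _ hβ]
        exact hmix j hj hjn i him
      · obtain ⟨p, hp⟩ := hYmul i him j hjm
        rw [compA_snd, compA_snd, ← Matrix.mul_kronecker_mul, hp, mul_one, ← kronLeft_apply,
          map_sum]
        refine Submodule.sum_mem _ fun k _ => ?_
        rw [map_smul]
        exact Submodule.smul_mem _ _ (hT2 k (by omega))
    rintro ⟨α, hα⟩ ⟨β, hβ⟩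
    obtain ⟨c, hc⟩ := (Submodule.mem_span_range_iff_exists_fun ℂ).1 (key α hα β hβ)
    exact ⟨c, hc.symm⟩
  · rintro ⟨α, hα⟩ ⟨β, hβ⟩
    exact hcomm α hα β hβ

end Helpers

/-- Theorem 4.2 (i): the composition of `P`-polynomial association schemes `𝔛` and `𝔜` is a
bivariate `P`-polynomial association scheme on `D = {(i,0)}ᵢ₌₁ⁿ ∪ {(0,j)}ⱼ₌₀ᵐ` with respect to
the lexicographic order. -/
theorem composition_isMultiPPoly {X Y : Type*} [Fintype X] [DecidableEq X]
    [Fintype Y] [DecidableEq Y] (n m : ℕ) (hn : 1 ≤ n) (hm : 1 ≤ m)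
    (A : ℕ → Matrix X X ℂ) (A' : ℕ → Matrix Y Y ℂ)
    (hXscheme : IsAssocScheme fun i : Fin (n + 1) => A i)
    (hYscheme : IsAssocScheme fun j : Fin (m + 1) => A' j)
    (hA0 : A 0 = 1) (hA'0 : A' 0 = 1)
    (hXsym : ∀ i ≤ n, (A i)ᵀ = A i) (hYsym : ∀ j ≤ m, (A' j)ᵀ = A' j)
    (hXP : ∀ i ≤ n, ∃ v : Polynomial ℂ, v.degree = (i : ℕ) ∧ A i = Polynomial.aeval (A 1) v)
    (hYP : ∀ j ≤ m, ∃ v : Polynomial ℂ, v.degree = (j : ℕ) ∧ A' j = Polynomial.aeval (A' 1) v)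
    (mo : MonOrder 2) (hmo : mo.le = fun a b => lexLe a b) :
    IsMultiPPoly (compD n m) mo (compA A A') := by
  have hJ : ∑ j ∈ Finset.range (m + 1), A' j = matJ Y := by
    rw [← hYscheme.sum_eq_J, Finset.sum_range]
  have hJcomm : A' 1 * matJ Y = matJ Y * A' 1 := hYscheme.commute_matJ ⟨1, by omega⟩
  obtain ⟨N, hN0, hN⟩ := matJ_mul_self Y
  obtain ⟨κ, hκ⟩ := exists_smul_matJ_of_commute hJcomm
  have hle : ∀ a b, mo.le a b ↔ a 0 < b 0 ∨ (a 0 = b 0 ∧ a 1 ≤ b 1) := by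
    intro a b
    rw [hmo]
    exact lexLe_two_iff
  set M : Fin 2 → Matrix (X × Y) (X × Y) ℂ := fun i => compA A A' (epsV i) with hM
  have hM0 : M 0 = A 1 ⊗ₖ matJ Y := by
    rw [hM]
    simp only [epsV_zero_two]
    exact compA_fst A A' le_rfl 0
  have hM1 : M 1 = (1 : Matrix X X ℂ) ⊗ₖ A' 1 := by
    rw [hM]
    simp only [epsV_one_two]
    exact compA_snd A A' 1
  have hfst : ∀ k, mpow M ![k + 1, 0] = N ^ k • ((A 1 ^ (k + 1)) ⊗ₖ matJ Y) := by
    intro k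
    rw [mpow_two, pow_zero, mul_one, hM0, kronecker_pow_succ_of_mul_self _ hN]
  have hsnd : ∀ k, mpow M ![0, k] = (1 : Matrix X X ℂ) ⊗ₖ (A' 1 ^ k) := by
    intro k
    rw [mpow_two, pow_zero, one_mul, hM1, one_kronecker_pow]
  -- Submodules containing the relevant monomials contain the images of the powers.
  have hsndJ : ∀ S : Submodule ℂ (Matrix (X × Y) (X × Y) ℂ),
      (∀ j ≤ m, mpow M ![0, j] ∈ S) → (1 : Matrix X X ℂ) ⊗ₖ matJ Y ∈ S := by
    intro S hS
    rw [← kronLeft_apply, ← hJ, map_sum]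
    refine S.sum_mem fun j hj => ?_
    refine mem_of_pow_mem hYP (S.comap (kronLeft 1)) (fun k hk => ?_)
      (Nat.lt_succ_iff.1 (Finset.mem_range.1 hj))
    rw [Submodule.mem_comap, kronLeft_apply, ← hsnd]
    exact hS k hk
  have hfstpow : ∀ S : Submodule ℂ (Matrix (X × Y) (X × Y) ℂ),
      (∀ j ≤ m, mpow M ![0, j] ∈ S) → ∀ k, (1 ≤ k → mpow M ![k, 0] ∈ S) →
      A 1 ^ k ∈ S.comap (kronRight (matJ Y)) := by
    intro S hS k hk
    rw [Submodule.mem_comap, kronRight_apply]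
    rcases k with _ | k
    · rw [pow_zero]
      exact hsndJ S hS
    · have h := hk (by omega)
      rw [hfst] at h
      exact (S.smul_mem_iff (pow_ne_zero k hN0)).1 h
  refine ⟨composition_isAssocScheme hXscheme hYscheme hA0 hA'0 hXsym hYsym, ?_, ?_, ?_, ?_⟩
  · intro i
    fin_cases i
    · exact mem_compD.2 (by simp [epsV, hn])
    · exact mem_compD.2 (by simp [epsV, hm])
  · intro α hα β hβ
    have h0 := hβ 0
    have h1 := hβ 1
    rw [mem_compD] at hα ⊢
    omega
  · intro α hα
    rcases exists_of_mem_compD hα with ⟨i, hi, hin, rfl⟩ | ⟨j, hjm, rfl⟩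
    · obtain ⟨i, rfl⟩ : ∃ k, i = k + 1 := ⟨i - 1, by omega⟩
      obtain ⟨v, hv, hAv⟩ := hXP (i + 1) hin
      have hv0 := leadingCoeff_ne_zero_of_degree_eq hv
      refine exists_poly_of_mem_span _ mo M hα
        (a := v.leadingCoeff * (N ^ i)⁻¹) (mul_ne_zero hv0 (inv_ne_zero (pow_ne_zero i hN0))) ?_
      rw [hfst, smul_smul, mul_assoc, inv_mul_cancel₀ (pow_ne_zero i hN0), mul_one,
        compA_fst A A' (by omega), hAv, ← kronRight_apply, ← kronRight_apply, ← map_smul,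
        ← map_sub]
      rw [← Submodule.mem_comap]
      refine aeval_sub_leading_mem _ ?_
        (Polynomial.natDegree_eq_of_degree_eq_some hv)
      intro k hk
      refine hfstpow _ (fun j hj => ?_) k fun hk1 => ?_
      · refine Submodule.subset_span ⟨_, ⟨mem_compD.2 (by simp [hj]), ?_, ?_⟩, rfl⟩
        · simp [hle]
        · intro h
          simpa using congrFun h 0
      · refine Submodule.subset_span ⟨_, ⟨mem_compD.2 (by simp; omega), ?_, ?_⟩, rfl⟩
        · simp [hle]; omega
        · intro h
          have := congrFun h 0
          simp at this
          omega
    · obtain ⟨v, hv, hAv⟩ := hYP j hjm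
      have hv0 := leadingCoeff_ne_zero_of_degree_eq hv
      refine exists_poly_of_mem_span _ mo M hα hv0 ?_
      rw [hsnd, compA_snd, hAv, ← kronLeft_apply, ← kronLeft_apply, ← map_smul, ← map_sub]
      rw [← Submodule.mem_comap]
      refine aeval_sub_leading_mem _ ?_
        (Polynomial.natDegree_eq_of_degree_eq_some hv)
      intro k hk
      rw [Submodule.mem_comap, kronLeft_apply, ← hsnd]
      refine Submodule.subset_span ⟨_, ⟨mem_compD.2 (by simp; omega), ?_, ?_⟩, rfl⟩
      · simp [hle]; omega
      · intro h
        have := congrFun h 1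
        simp at this
        omega
  · intro i α hα
    suffices h : M i * mpow M α ∈ Submodule.span ℂ
        (mpow M '' {β | β ∈ compD n m ∧ mo.le β (α + epsV i)}) by
      obtain ⟨c, hc, hc'⟩ := exists_coeff_of_mem_span _ _ _ h
      exact ⟨c, hc, fun β _ => hc' β⟩
    have hmem : ∀ a b, ((1 ≤ a ∧ a ≤ n ∧ b = 0) ∨ (a = 0 ∧ b ≤ m)) →
        (a < (α + epsV i) 0 ∨ (a = (α + epsV i) 0 ∧ b ≤ (α + epsV i) 1)) →
        mpow M ![a, b] ∈ Submodule.span ℂ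
          (mpow M '' {β | β ∈ compD n m ∧ mo.le β (α + epsV i)}) := by
      intro a b h1 h2
      exact Submodule.subset_span
        ⟨_, ⟨mem_compD.2 (by simpa using h1), (hle _ _).2 (by simpa using h2)⟩, rfl⟩
    match i with
    | 0 =>
      rcases exists_of_mem_compD hα with ⟨a, ha, han, rfl⟩ | ⟨j, hjm, rfl⟩
      · have h1 : M 0 * mpow M ![a, 0] = N ^ a • ((A 1 ^ (a + 1)) ⊗ₖ matJ Y) := by
          rw [← hfst, mpow_two, mpow_two, pow_zero, mul_one, mul_one, pow_succ']
        rw [h1]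
        refine Submodule.smul_mem _ _ ?_
        have hpow : ∀ k ≤ n, k ≤ a + 1 → A 1 ^ k ∈ Submodule.comap (kronRight (matJ Y))
            (Submodule.span ℂ
              (mpow M '' {β | β ∈ compD n m ∧ mo.le β (![a, 0] + epsV 0)})) :=
          fun k hk hka => hfstpow _
            (fun j hj => hmem 0 j (by omega) (by simp [epsV])) k
            fun hk1 => hmem k 0 (by omega) (by simp [epsV]; omega)
        rcases han.lt_or_eq with hlt | rfl
        · exact hpow (a + 1) hlt le_rfl
        · exact pow_mem_of_pow_le_mem hn hXscheme hA0 hXP _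
            (fun k hk => hpow k hk (by omega)) (a + 1)
      · have h1 : ∀ j, M 0 * mpow M ![0, j] = κ ^ j • mpow M ![1, 0] := by
          intro j
          induction j with
          | zero => simp [mpow_two]
          | succ j ih =>
            have h2 : mpow M ![0, j + 1] = mpow M ![0, j] * M 1 := by
              simp [mpow_two, pow_succ]
            rw [h2, ← mul_assoc, ih, hfst 0, hM1]
            simp only [Matrix.smul_mul, ← Matrix.mul_kronecker_mul, ← hJcomm, hκ, mul_one,
              Matrix.kronecker_smul, smul_smul, pow_zero, pow_succ]
        rw [h1]
        exact Submodule.smul_mem _ _ (hmem 1 0 (by omega) (by simp [epsV]))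
    | 1 =>
      rcases exists_of_mem_compD hα with ⟨a, ha, han, rfl⟩ | ⟨j, hjm, rfl⟩
      · obtain ⟨a, rfl⟩ : ∃ k, a = k + 1 := ⟨a - 1, by omega⟩
        have h1 : M 1 * mpow M ![a + 1, 0] = κ • mpow M ![a + 1, 0] := by
          rw [hfst, hM1, Matrix.mul_smul, ← Matrix.mul_kronecker_mul, hκ, one_mul,
            Matrix.kronecker_smul, smul_comm]
        rw [h1]
        exact Submodule.smul_mem _ _ (hmem _ _ (by omega) (by simp [epsV]))
      · have h1 : M 1 * mpow M ![0, j] = kronLeft 1 (A' 1 ^ (j + 1)) := by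
          rw [kronLeft_apply, ← hsnd, mpow_two, mpow_two, pow_zero, one_mul, one_mul, pow_succ']
        rw [h1]
        have hpow : ∀ k ≤ m, k ≤ j + 1 → A' 1 ^ k ∈ Submodule.comap (kronLeft (1 : Matrix X X ℂ))
            (Submodule.span ℂ
              (mpow M '' {β | β ∈ compD n m ∧ mo.le β (![0, j] + epsV 1)})) := by
          intro k hk hkj
          rw [Submodule.mem_comap, kronLeft_apply, ← hsnd]
          exact hmem 0 k (by omega) (by simp [epsV]; omega)
        rcases hjm.lt_or_eq with hlt | rfl
        · exact hpow (j + 1) hlt le_rfl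
        · exact pow_mem_of_pow_le_mem hm hYscheme hA'0 hYP _
            (fun k hk => hpow k hk (by omega)) (j + 1)
end

section
/- Let 𝔛 = (X, {R_i}_{i=0}^ℓ) be a commutative association scheme of class ℓ and n ≥ 1. Then the extension S^n(𝔛) = (X^n, ℛ), where ℛ(x,y) := (τ₁(x,y),…,τ_ℓ(x,y)) with τ_i(x,y) := |{t ∈ {1,…,n} : (x_t,y_t) ∈ R_i}|, is an ℓ-variate P-polynomial association scheme on the domain D := {α ∈ ℕ^ℓ : |α| ≤ n} with respect to the graded lexicographic order ≤_grlex. -/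
open scoped BigOperators
open Matrix

open scoped Classical

section Extension

variable {X : Type*} [Fintype X] [DecidableEq X]

/-- The adjacency matrices of the extension `S^n(𝔛)` on `X^n`: `x, y` are in relation
`α ∈ ℕ^ℓ` iff `τ_i(x,y) = |{t : (x_t, y_t) ∈ R_i}| = α i` for `i = 1,…,ℓ`. -/
noncomputable def extA (ℓ n : ℕ) (A : ℕ → Matrix X X ℂ) :
    (Fin ℓ → ℕ) → Matrix (Fin n → X) (Fin n → X) ℂ :=
  fun α => Matrix.of fun x y =>
    if ∀ i : Fin ℓ,
        (Finset.univ.filter fun t : Fin n => A ((i : ℕ) + 1) (x t) (y t) = 1).card = α i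
    then 1 else 0

/-- The primitive idempotents of the extension `S^n(𝔛)`: the symmetrized tensors of the
primitive idempotents `E_0, …, E_ℓ` of `𝔛` (each distinct place-permutation of
`E_1^{⊗ α 1} ⊗ ⋯ ⊗ E_ℓ^{⊗ α ℓ} ⊗ E_0^{⊗ (n - |α|)}` appearing exactly once). -/
noncomputable def extE (ℓ n : ℕ) (E : ℕ → Matrix X X ℂ) :
    (Fin ℓ → ℕ) → Matrix (Fin n → X) (Fin n → X) ℂ :=
  fun α => Matrix.of fun x y =>
    ∑ g ∈ Finset.univ.filter (fun g : Fin n → Fin (ℓ + 1) =>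
        ∀ i : Fin ℓ, (Finset.univ.filter fun t => g t = Fin.succ i).card = α i),
      ∏ t, E ((g t : ℕ)) (x t) (y t)

/-- The domain `D = {α ∈ ℕ^ℓ : |α| ≤ n}` of the extension. -/
def extD (ℓ n : ℕ) : Finset (Fin ℓ → ℕ) :=
  (Fintype.piFinset fun _ : Fin ℓ => Finset.range (n + 1)).filter fun α => ∑ i, α i ≤ n

end Extension

section MonomialSpan

variable {Y : Type*} [Fintype Y] [DecidableEq Y] {ℓ : ℕ}

lemma sum_epsV (i : Fin ℓ) : ∑ j, epsV i j = 1 := by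
  simp [epsV]

lemma sum_add_epsV (α : Fin ℓ → ℕ) (i : Fin ℓ) :
    ∑ j, (α + epsV i) j = ∑ j, α j + 1 := by
  simp only [Pi.add_apply, Finset.sum_add_distrib, sum_epsV]

lemma exists_eq_add_epsV {α : Fin ℓ → ℕ} (h : α ≠ 0) : ∃ i β, α = β + epsV i := by
  obtain ⟨i, hi⟩ := Function.ne_iff.mp h
  refine ⟨i, α - epsV i, ?_⟩
  ext j
  by_cases hj : j = i
  · subst hj
    simp [epsV] at hi ⊢
    omega
  · simp [epsV, hj]

lemma mem_extD {n : ℕ} {α : Fin ℓ → ℕ} : α ∈ extD ℓ n ↔ ∑ i, α i ≤ n := by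
  simp only [extD, Finset.mem_filter, Fintype.mem_piFinset, Finset.mem_range, and_iff_right_iff_imp]
  intro h i
  have := Finset.single_le_sum (f := α) (fun _ _ => Nat.zero_le _) (Finset.mem_univ i)
  omega

lemma mpow_zero (M : Fin ℓ → Matrix Y Y ℂ) : mpow M 0 = 1 := by
  simp [mpow]

lemma mpow_add_epsV (M : Fin ℓ → Matrix Y Y ℂ) (hM : ∀ i j, Commute (M i) (M j))
    (β : Fin ℓ → ℕ) (i : Fin ℓ) : mpow M (β + epsV i) = M i * mpow M β := by
  have key : ∀ l : List (Fin ℓ), l.Nodup →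
      (l.map fun j => M j ^ (β + epsV i) j).prod =
        (if i ∈ l then M i else 1) * (l.map fun j => M j ^ β j).prod := by
    intro l hl
    induction l with
    | nil => simp
    | cons j l ih =>
      rw [List.nodup_cons] at hl
      rw [List.map_cons, List.prod_cons, List.map_cons, List.prod_cons, ih hl.2]
      by_cases hj : j = i
      · subst hj
        simp [hl.1, epsV, pow_succ', mul_assoc]
      · have hp : (β + epsV i) j = β j := by simp [epsV, hj]
        have hc : Commute (M j ^ β j) (if i ∈ l then M i else 1) := by
          split_ifs
          · exact (hM j i).pow_left _
          · exact Commute.one_right _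
        rw [hp, ← mul_assoc, hc.eq, mul_assoc]
        simp [Ne.symm hj]
  simpa [mpow] using key _ (List.nodup_finRange ℓ)

/-- The span of the monomials in `M` of total degree less than `d`. -/
def mpowSpan (M : Fin ℓ → Matrix Y Y ℂ) (d : ℕ) : Submodule ℂ (Matrix Y Y ℂ) :=
  Submodule.span ℂ (mpow M '' {β | ∑ i, β i < d})

lemma mpowSpan_mono (M : Fin ℓ → Matrix Y Y ℂ) {d e : ℕ} (h : d ≤ e) :
    mpowSpan M d ≤ mpowSpan M e :=
  Submodule.span_mono (Set.image_mono fun _ hβ => lt_of_lt_of_le hβ h)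

lemma mpow_mem_mpowSpan (M : Fin ℓ → Matrix Y Y ℂ) {β : Fin ℓ → ℕ} {d : ℕ}
    (h : ∑ i, β i < d) : mpow M β ∈ mpowSpan M d :=
  Submodule.subset_span ⟨β, h, rfl⟩

lemma mul_mem_mpowSpan (M : Fin ℓ → Matrix Y Y ℂ) (hM : ∀ i j, Commute (M i) (M j))
    (i : Fin ℓ) {d : ℕ} {B : Matrix Y Y ℂ} (hB : B ∈ mpowSpan M d) :
    M i * B ∈ mpowSpan M (d + 1) := by
  have hle : mpowSpan M d ≤ (mpowSpan M (d + 1)).comap (LinearMap.mulLeft ℂ (M i)) := by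
    refine Submodule.span_le.mpr ?_
    rintro _ ⟨β, hβ, rfl⟩
    have hβ' : ∑ i, β i < d := hβ
    simp only [Submodule.comap_coe, Set.mem_preimage, LinearMap.mulLeft_apply, SetLike.mem_coe]
    rw [← mpow_add_epsV M hM]
    refine mpow_mem_mpowSpan M ?_
    rw [sum_add_epsV]
    omega
  exact hle hB

lemma exists_coeff_of_mem_mpowSpan (M : Fin ℓ → Matrix Y Y ℂ) {n d : ℕ} (hd : d ≤ n + 1)
    {B : Matrix Y Y ℂ} (hB : B ∈ mpowSpan M d) :
    ∃ c : (Fin ℓ → ℕ) → ℂ, B = ∑ β ∈ extD ℓ n, c β • mpow M β ∧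
      ∀ β, c β ≠ 0 → ∑ i, β i < d := by
  induction hB using Submodule.span_induction with
  | mem B hB =>
    obtain ⟨α, hα, rfl⟩ := hB
    have hα' : ∑ i, α i < d := hα
    refine ⟨Pi.single α 1, ?_, ?_⟩
    · rw [Finset.sum_eq_single_of_mem α (mem_extD.mpr (by omega))]
      · simp
      · intro β _ hβ
        simp [hβ]
    · intro β hβ
      by_cases h : β = α
      · rwa [h]
      · simp [h] at hβ
  | zero => exact ⟨0, by simp, by simp⟩
  | add B C _ _ ihB ihC =>
    obtain ⟨b, rfl, hb⟩ := ihB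
    obtain ⟨c, rfl, hc⟩ := ihC
    refine ⟨b + c, by simp [add_smul, Finset.sum_add_distrib], fun β hβ => ?_⟩
    by_cases h : b β = 0
    · exact hc β (by simpa [h] using hβ)
    · exact hb β h
  | smul a B _ ih =>
    obtain ⟨b, rfl, hb⟩ := ih
    refine ⟨a • b, by simp [Finset.smul_sum, mul_smul], fun β hβ => hb β ?_⟩
    exact right_ne_zero_of_mul (by simpa using hβ)

/-- If `E (ε i) * E α` agrees with `(α i + 1) • E (α + ε i)` up to terms of total degree at most
`|α|`, then each `E α` is a nonzero multiple of the monomial of exponent `α` in the `E (ε i)`,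
up to monomials of smaller total degree. -/
lemma exists_sub_smul_mpow_mem (E : (Fin ℓ → ℕ) → Matrix Y Y ℂ) (h0 : E 0 = 1)
    (hcomm : ∀ i j, Commute (E (epsV i)) (E (epsV j)))
    (hmul : ∀ i α, E (epsV i) * E α - ((α i : ℂ) + 1) • E (α + epsV i) ∈
      Submodule.span ℂ (E '' {β | ∑ j, β j ≤ ∑ j, α j}))
    (α : Fin ℓ → ℕ) :
    ∃ c : ℂ, c ≠ 0 ∧
      E α - c • mpow (fun i => E (epsV i)) α ∈
        mpowSpan (fun i => E (epsV i)) (∑ i, α i) := by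
  set M : Fin ℓ → Matrix Y Y ℂ := fun i => E (epsV i) with hM
  induction hd : ∑ i, α i using Nat.strong_induction_on generalizing α with
  | _ d ih =>
    by_cases hα : α = 0
    · exact ⟨1, one_ne_zero, by simp [hα, h0, mpow_zero]⟩
    obtain ⟨i, β, rfl⟩ := exists_eq_add_epsV hα
    rw [sum_add_epsV] at hd
    have hlow : Submodule.span ℂ (E '' {γ | ∑ j, γ j ≤ ∑ j, β j}) ≤ mpowSpan M d := by
      refine Submodule.span_le.mpr ?_
      rintro _ ⟨γ, hγ, rfl⟩
      have hγ' : ∑ j, γ j ≤ ∑ j, β j := hγ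
      obtain ⟨c, -, hc⟩ := ih (∑ j, γ j) (by omega) γ rfl
      have := add_mem (mpowSpan_mono M (show ∑ j, γ j ≤ d by omega) hc)
        (Submodule.smul_mem _ c (mpow_mem_mpowSpan M (show ∑ j, γ j < d by omega)))
      simpa using this
    obtain ⟨c, hc, hmem⟩ := ih (∑ j, β j) (by omega) β rfl
    have hne : (β i : ℂ) + 1 ≠ 0 := Nat.cast_add_one_ne_zero _
    refine ⟨((β i : ℂ) + 1)⁻¹ * c, mul_ne_zero (inv_ne_zero hne) hc, ?_⟩
    have h1 := mul_mem_mpowSpan M hcomm i hmem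
    rw [hd, mul_sub, mul_smul_comm, ← mpow_add_epsV M hcomm] at h1
    have h2 := Submodule.smul_mem _ ((β i : ℂ) + 1)⁻¹ (sub_mem h1 (hlow (hmul i β)))
    convert h2 using 1
    rw [smul_sub, smul_sub, smul_sub, smul_smul, smul_smul, inv_mul_cancel₀ hne, one_smul]
    abel

/-- A combination of monomial matrices is the value of a polynomial. -/
lemma exists_matEval_eq (M : Fin ℓ → Matrix Y Y ℂ) (D : Finset (Fin ℓ → ℕ))
    (c : (Fin ℓ → ℕ) → ℂ) :
    ∃ v : MvPolynomial (Fin ℓ) ℂ, matEval v M = ∑ β ∈ D, c β • mpow M β ∧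
      ∀ d : Fin ℓ →₀ ℕ, MvPolynomial.coeff d v = if ⇑d ∈ D then c ⇑d else 0 := by
  have hcoeff : ∀ d : Fin ℓ →₀ ℕ, MvPolynomial.coeff d
      (∑ β ∈ D, MvPolynomial.monomial (toExp β) (c β)) = if ⇑d ∈ D then c ⇑d else 0 := by
    intro d
    have h : ∀ β, toExp β = d ↔ ⇑d = β := fun β =>
      ⟨fun h => by rw [← h]; rfl,
        fun h => by rw [← h]; exact Finsupp.equivFunOnFinite.symm_apply_apply d⟩
    simp [MvPolynomial.coeff_sum, MvPolynomial.coeff_monomial, h]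
  refine ⟨_, ?_, hcoeff⟩
  set v := ∑ β ∈ D, MvPolynomial.monomial (toExp β) (c β)
  have hsub : v.support ⊆ D.image toExp := by
    intro d hd
    rw [MvPolynomial.mem_support_iff, hcoeff] at hd
    exact Finset.mem_image.mpr ⟨d, by by_contra h; simp [h] at hd,
      Finsupp.equivFunOnFinite.symm_apply_apply d⟩
  rw [matEval, Finset.sum_subset hsub, Finset.sum_image]
  · refine Finset.sum_congr rfl fun β hβ => ?_
    have hβ' : ⇑(toExp β) = β := rfl
    rw [hcoeff, hβ', if_pos hβ]
  · exact fun a _ b _ h => Finsupp.equivFunOnFinite.symm.injective h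
  · intro d _ hd
    rw [MvPolynomial.notMem_support_iff.mp hd, zero_smul]

end MonomialSpan

section RelationType

variable {X : Type*} {ℓ n : ℕ}

/-- The exponent in `ℕ^ℓ` of a relation index: `0` for the identity relation, and the
standard unit vector `ε i` for the relation `i + 1`. -/
def relExp (k : Fin (ℓ + 1)) : Fin ℓ → ℕ := fun i => if k = i.succ then 1 else 0

lemma relExp_zero : relExp (0 : Fin (ℓ + 1)) = 0 := by
  ext i
  simp [relExp, (Fin.succ_ne_zero i).symm]

lemma relExp_succ (i : Fin ℓ) : relExp i.succ = epsV i := by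
  ext j
  by_cases h : j = i
  · simp [relExp, epsV, h]
  · simp [relExp, epsV, h, Ne.symm h]

lemma relExp_eq_zero_iff {k : Fin (ℓ + 1)} : relExp k = 0 ↔ k = 0 := by
  refine ⟨fun h => ?_, fun h => h ▸ relExp_zero⟩
  by_contra hk
  obtain ⟨i, rfl⟩ := Fin.exists_succ_eq.mpr hk
  simpa [relExp] using congrFun h i

lemma sum_relExp_le (k : Fin (ℓ + 1)) : ∑ i, relExp k i ≤ 1 := by
  refine Fin.cases ?_ (fun i => ?_) k
  · simp [relExp_zero]
  · rw [relExp_succ, sum_epsV]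

/-- The vector `τ(x, y)` counting the coordinates of `(x, y)` in each relation. -/
def relType (r : X → X → Fin (ℓ + 1)) (x y : Fin n → X) : Fin ℓ → ℕ :=
  ∑ t, relExp (r (x t) (y t))

lemma relType_apply (r : X → X → Fin (ℓ + 1)) (x y : Fin n → X) (i : Fin ℓ) :
    relType r x y i = (Finset.univ.filter fun t => r (x t) (y t) = i.succ).card := by
  simp [relType, relExp, Finset.sum_apply]

lemma sum_relType_le (r : X → X → Fin (ℓ + 1)) (x y : Fin n → X) :
    ∑ i, relType r x y i ≤ n := by
  simp only [relType, Finset.sum_apply]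
  rw [Finset.sum_comm]
  refine (Finset.sum_le_sum fun t _ => sum_relExp_le (r (x t) (y t))).trans ?_
  simp

lemma relType_eq_zero_iff {r : X → X → Fin (ℓ + 1)} (hr : ∀ a b, r a b = 0 ↔ a = b)
    {x y : Fin n → X} : relType r x y = 0 ↔ x = y := by
  rw [relType, Finset.sum_eq_zero_iff, funext_iff]
  simp [relExp_eq_zero_iff, hr]

lemma relType_update (r : X → X → Fin (ℓ + 1)) (x y : Fin n → X) (t : Fin n) (w : X) :
    relType r (Function.update x t w) y + relExp (r (x t) (y t)) =
      relType r x y + relExp (r w (y t)) := by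
  rw [relType, relType, ← Finset.add_sum_erase _ _ (Finset.mem_univ t),
    ← Finset.add_sum_erase _ (fun s => relExp (r (x s) (y s))) (Finset.mem_univ t)]
  have h : ∑ s ∈ Finset.univ.erase t, relExp (r (Function.update x t w s) (y s)) =
      ∑ s ∈ Finset.univ.erase t, relExp (r (x s) (y s)) :=
    Finset.sum_congr rfl fun s hs => by
      rw [Function.update_of_ne (Finset.ne_of_mem_erase hs)]
  rw [h, Function.update_self]
  abel

lemma relType_update_self {r : X → X → Fin (ℓ + 1)} (hr : ∀ a b, r a b = 0 ↔ a = b)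
    (x : Fin n → X) (t : Fin n) (w : X) :
    relType r x (Function.update x t w) = relExp (r (x t) w) := by
  rw [relType, Finset.sum_eq_single_of_mem t (Finset.mem_univ t), Function.update_self]
  intro s _ hs
  rw [Function.update_of_ne hs, (hr _ _).mpr rfl, relExp_zero]

lemma exists_update_of_relType_eq_epsV {r : X → X → Fin (ℓ + 1)}
    (hr : ∀ a b, r a b = 0 ↔ a = b) {x z : Fin n → X} {i : Fin ℓ}
    (h : relType r x z = epsV i) :
    ∃ t, r (x t) (z t) = i.succ ∧ Function.update x t (z t) = z := by
  obtain ⟨t, ht⟩ : ∃ t, r (x t) (z t) = i.succ := by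
    have h1 := congrFun h i
    rw [relType_apply] at h1
    have h2 : (Finset.univ.filter fun t => r (x t) (z t) = i.succ).Nonempty := by
      rw [← Finset.card_pos, h1]
      simp [epsV]
    obtain ⟨t, ht⟩ := h2
    exact ⟨t, (Finset.mem_filter.mp ht).2⟩
  refine ⟨t, ht, ?_⟩
  rw [relType, ← Finset.add_sum_erase _ _ (Finset.mem_univ t), ht, relExp_succ,
    add_eq_left, Finset.sum_eq_zero_iff] at h
  ext s
  by_cases hs : s = t
  · rw [hs, Function.update_self]
  · rw [Function.update_of_ne hs]
    have := h s (Finset.mem_erase.mpr ⟨hs, Finset.mem_univ s⟩)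
    rwa [relExp_eq_zero_iff, hr] at this

lemma sum_ite_relType_eq_epsV [Fintype X] {r : X → X → Fin (ℓ + 1)}
    (hr : ∀ a b, r a b = 0 ↔ a = b) (x : Fin n → X) (i : Fin ℓ) (F : (Fin n → X) → ℂ) :
    ∑ z, (if relType r x z = epsV i then F z else 0) =
      ∑ t, ∑ w, if r (x t) w = i.succ then F (Function.update x t w) else 0 := by
  rw [← Fintype.sum_prod_type' (f := fun t w =>
    if r (x t) w = i.succ then F (Function.update x t w) else 0),
    ← Finset.sum_filter, ← Finset.sum_filter]
  symm
  refine Finset.sum_bij (fun p _ => Function.update x p.1 p.2) ?_ ?_ ?_ (fun _ _ => rfl)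
  · intro p hp
    simp only [Finset.mem_filter, Finset.mem_univ, true_and] at hp ⊢
    rw [relType_update_self hr, hp, relExp_succ]
  · rintro ⟨t, w⟩ hp ⟨t', w'⟩ hp' h
    simp only [Finset.mem_filter, Finset.mem_univ, true_and] at hp hp' h
    have hw : x t ≠ w := fun e => Fin.succ_ne_zero i (hp.symm.trans ((hr _ _).mpr e))
    have htt : t = t' := by
      by_contra hne
      have := congrFun h t
      rw [Function.update_self, Function.update_of_ne hne] at this
      exact hw this.symm
    subst htt
    have := congrFun h t
    rw [Function.update_self, Function.update_self] at this
    rw [this]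
  · intro z hz
    simp only [Finset.mem_filter, Finset.mem_univ, true_and] at hz
    obtain ⟨t, ht, hz'⟩ := exists_update_of_relType_eq_epsV hr hz
    exact ⟨(t, z t), by simpa using ht, hz'⟩

/-- The 0-1 matrix of the pairs of type `α`. -/
def typeMat (n : ℕ) (r : X → X → Fin (ℓ + 1)) (α : Fin ℓ → ℕ) :
    Matrix (Fin n → X) (Fin n → X) ℂ :=
  Matrix.of fun x y => if relType r x y = α then 1 else 0

lemma typeMat_apply (r : X → X → Fin (ℓ + 1)) (α : Fin ℓ → ℕ) (x y : Fin n → X) :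
    typeMat n r α x y = if relType r x y = α then 1 else 0 := rfl

lemma typeMat_eq_zero (r : X → X → Fin (ℓ + 1)) {α : Fin ℓ → ℕ} (hα : n < ∑ i, α i) :
    typeMat n r α = 0 := by
  ext x y
  rw [typeMat_apply, if_neg]
  · rfl
  · rintro rfl
    exact absurd (sum_relType_le r x y) (not_le.mpr hα)

lemma typeMat_zero [DecidableEq X] {r : X → X → Fin (ℓ + 1)}
    (hr : ∀ a b, r a b = 0 ↔ a = b) : typeMat n r 0 = 1 := by
  ext x y
  simp [typeMat_apply, Matrix.one_apply, relType_eq_zero_iff hr]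

/-- A matrix whose entries depend only on the type is a combination of the `typeMat n r β`. -/
lemma of_relType_eq_sum (r : X → X → Fin (ℓ + 1)) (h : (Fin ℓ → ℕ) → ℂ) :
    Matrix.of (fun x y : Fin n → X => h (relType r x y)) =
      ∑ β ∈ extD ℓ n, h β • typeMat n r β := by
  ext x y
  have := sum_relType_le r x y
  simp [Matrix.sum_apply, typeMat_apply, mem_extD, this]

/-- The number of coordinates in each relation, the identity included, as a function of the
type. -/
def fullType (n : ℕ) (β : Fin ℓ → ℕ) : Fin (ℓ + 1) → ℕ :=
  Fin.cases (n - ∑ i, β i) β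

lemma card_filter_eq_fullType (r : X → X → Fin (ℓ + 1)) (x y : Fin n → X) (k : Fin (ℓ + 1)) :
    (Finset.univ.filter fun t => r (x t) (y t) = k).card = fullType n (relType r x y) k := by
  have hsucc : ∀ i : Fin ℓ, (Finset.univ.filter fun t => r (x t) (y t) = i.succ).card =
      fullType n (relType r x y) i.succ := fun i => (relType_apply r x y i).symm
  refine Fin.cases ?_ hsucc k
  have h : n = ∑ k, (Finset.univ.filter fun t => r (x t) (y t) = k).card := by
    simpa using Finset.card_eq_sum_card_fiberwise (s := (Finset.univ : Finset (Fin n)))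
      (t := Finset.univ) (f := fun t => r (x t) (y t)) (fun _ _ => Finset.mem_univ _)
  rw [Fin.sum_univ_succ] at h
  simp only [← relType_apply] at h
  change _ = n - ∑ i, relType r x y i
  omega

lemma typeMat_epsV_mul_apply [Fintype X] {r : X → X → Fin (ℓ + 1)}
    (hr : ∀ a b, r a b = 0 ↔ a = b) (i : Fin ℓ) (α : Fin ℓ → ℕ) (x y : Fin n → X) :
    (typeMat n r (epsV i) * typeMat n r α) x y =
      ∑ t, ∑ j, ((Finset.univ.filter fun w => r (x t) w = i.succ ∧ r w (y t) = j).card : ℂ) *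
        if relType r x y + relExp j = α + relExp (r (x t) (y t)) then 1 else 0 := by
  simp only [Matrix.mul_apply, typeMat_apply, ite_mul, one_mul, zero_mul]
  rw [sum_ite_relType_eq_epsV hr]
  refine Finset.sum_congr rfl fun t _ => ?_
  have hiff : ∀ w, relType r (Function.update x t w) y = α ↔
      relType r x y + relExp (r w (y t)) = α + relExp (r (x t) (y t)) := fun w => by
    rw [← relType_update r x y t w, add_left_inj]
  simp only [hiff, Finset.card_filter, Nat.cast_sum, Finset.sum_mul]
  rw [Finset.sum_comm]
  refine Finset.sum_congr rfl fun w _ => ?_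
  rw [Finset.sum_eq_single_of_mem (r w (y t)) (Finset.mem_univ _)]
  · by_cases h : r (x t) w = i.succ <;> simp [h]
  · intro j _ hj
    simp [Ne.symm hj]

lemma typeMat_epsV_mul_apply_of_lt [Fintype X] {r : X → X → Fin (ℓ + 1)}
    (hr : ∀ a b, r a b = 0 ↔ a = b) (i : Fin ℓ) (α : Fin ℓ → ℕ) {x y : Fin n → X}
    (h : ∑ i, α i < ∑ i, relType r x y i) :
    (typeMat n r (epsV i) * typeMat n r α) x y =
      ((α i : ℂ) + 1) * typeMat n r (α + epsV i) x y := by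
  have hterm : ∀ t, ∑ j, ((Finset.univ.filter fun w =>
        r (x t) w = i.succ ∧ r w (y t) = j).card : ℂ) *
        (if relType r x y + relExp j = α + relExp (r (x t) (y t)) then 1 else 0) =
      (if r (x t) (y t) = i.succ then 1 else 0) * typeMat n r (α + epsV i) x y := by
    intro t
    rw [Finset.sum_eq_single_of_mem 0 (Finset.mem_univ _)]
    · simp only [hr, relExp_zero, add_zero, typeMat_apply]
      by_cases hi : r (x t) (y t) = i.succ
      · have hset : (Finset.univ.filter fun w => r (x t) w = i.succ ∧ w = y t) = {y t} := by
          ext w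
          simp only [Finset.mem_filter, Finset.mem_univ, true_and, Finset.mem_singleton]
          exact ⟨fun h => h.2, fun h => ⟨h ▸ hi, h⟩⟩
        rw [hset, hi, relExp_succ]
        simp
      · have hset : (Finset.univ.filter fun w => r (x t) w = i.succ ∧ w = y t) = ∅ := by
          ext w
          simp only [Finset.mem_filter, Finset.mem_univ, true_and, Finset.notMem_empty, iff_false]
          rintro ⟨h, rfl⟩
          exact hi h
        rw [hset, if_neg hi]
        simp
    · intro j _ hj
      rw [if_neg, mul_zero]
      intro he
      obtain ⟨j, rfl⟩ := Fin.exists_succ_eq.mpr hj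
      have h1 : ∑ i, (relType r x y + relExp j.succ) i = _ := congrArg (fun f => ∑ i, f i) he
      rw [relExp_succ, sum_add_epsV] at h1
      simp only [Pi.add_apply, Finset.sum_add_distrib] at h1
      have := sum_relExp_le (r (x t) (y t))
      omega
  rw [typeMat_epsV_mul_apply hr, Finset.sum_congr rfl fun t _ => hterm t, ← Finset.sum_mul,
    typeMat_apply]
  by_cases he : relType r x y = α + epsV i
  · have := relType_apply r x y i
    rw [he] at this
    rw [Finset.sum_boole, ← this]
    simp [epsV]
  · simp [he]

/-- `r` has intersection numbers: the number of `w` with `r x w = i` and `r w y = j` depends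
only on `r x y`. -/
def HasIntersectionNumbers [Fintype X] (r : X → X → Fin (ℓ + 1)) : Prop :=
  ∃ P : Fin (ℓ + 1) → Fin (ℓ + 1) → Fin (ℓ + 1) → ℂ, ∀ i j x y,
    ((Finset.univ.filter fun w => r x w = i ∧ r w y = j).card : ℂ) = P i j (r x y)

lemma exists_typeMat_epsV_mul_apply [Fintype X] {r : X → X → Fin (ℓ + 1)}
    (hr : ∀ a b, r a b = 0 ↔ a = b) (hP : HasIntersectionNumbers r)
    (i : Fin ℓ) (α : Fin ℓ → ℕ) :
    ∃ f : (Fin ℓ → ℕ) → ℂ, ∀ x y : Fin n → X,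
      (typeMat n r (epsV i) * typeMat n r α) x y = f (relType r x y) := by
  obtain ⟨P, hP⟩ := hP
  refine ⟨fun β => ∑ k, (fullType n β k : ℂ) *
    ∑ j, P i.succ j k * if β + relExp j = α + relExp k then 1 else 0, fun x y => ?_⟩
  simp only [typeMat_epsV_mul_apply hr, hP, ← card_filter_eq_fullType]
  rw [← Finset.sum_fiberwise' Finset.univ (fun t => r (x t) (y t))
    (fun k => ∑ j, P i.succ j k *
      if relType r x y + relExp j = α + relExp k then (1 : ℂ) else 0)]
  simp

lemma typeMat_epsV_mul_mem [Fintype X] {r : X → X → Fin (ℓ + 1)}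
    (hr : ∀ a b, r a b = 0 ↔ a = b) (hP : HasIntersectionNumbers r)
    (i : Fin ℓ) (α : Fin ℓ → ℕ) :
    typeMat n r (epsV i) * typeMat n r α - ((α i : ℂ) + 1) • typeMat n r (α + epsV i) ∈
      Submodule.span ℂ (typeMat n r '' {β | ∑ j, β j ≤ ∑ j, α j}) := by
  obtain ⟨f, hf⟩ := exists_typeMat_epsV_mul_apply (n := n) hr hP i α
  have heq : typeMat n r (epsV i) * typeMat n r α -
      ((α i : ℂ) + 1) • typeMat n r (α + epsV i) =
      Matrix.of (fun x y : Fin n → X =>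
        (fun β : Fin ℓ → ℕ => if ∑ j, β j ≤ ∑ j, α j then f β else 0) (relType r x y)) := by
    ext x y
    rw [Matrix.sub_apply, Matrix.smul_apply, smul_eq_mul, Matrix.of_apply]
    by_cases h : ∑ j, relType r x y j ≤ ∑ j, α j
    · have hne : relType r x y ≠ α + epsV i := by
        intro he
        rw [he, sum_add_epsV] at h
        omega
      rw [hf, typeMat_apply, if_neg hne]
      simp [h]
    · rw [typeMat_epsV_mul_apply_of_lt hr i α (not_le.mp h)]
      simp [h]
  rw [heq, of_relType_eq_sum r fun β => if ∑ j, β j ≤ ∑ j, α j then f β else 0]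
  refine sum_mem fun β _ => ?_
  split_ifs with h
  · exact Submodule.smul_mem _ _ (Submodule.subset_span ⟨β, h, rfl⟩)
  · simp

lemma typeMat_mul_comm [Fintype X] {r : X → X → Fin (ℓ + 1)}
    (hC : ∀ i j x y, (Finset.univ.filter fun w => r x w = i ∧ r w y = j).card =
      (Finset.univ.filter fun w => r x w = j ∧ r w y = i).card) (α β : Fin ℓ → ℕ) :
    typeMat n r α * typeMat n r β = typeMat n r β * typeMat n r α := by
  have hswap : ∀ x y, ∃ φ : X ≃ X, ∀ w, r x (φ w) = r w y ∧ r (φ w) y = r x w := by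
    intro x y
    have e : ∀ c : Fin (ℓ + 1) × Fin (ℓ + 1),
        Nonempty ({w // (r w y, r x w) = c} ≃ {w // (r x w, r w y) = c}) := by
      rintro ⟨i, j⟩
      refine Fintype.card_eq.mp ?_
      rw [Fintype.card_subtype, Fintype.card_subtype]
      simpa [and_comm] using hC j i x y
    refine ⟨Equiv.ofFiberEquiv fun c => (e c).some, fun w => ?_⟩
    simpa using Equiv.ofFiberEquiv_map (fun c => (e c).some) w
  choose φ hφ using hswap
  ext x y
  rw [Matrix.mul_apply, Matrix.mul_apply]
  refine (Fintype.sum_equiv (Equiv.piCongrRight fun t => φ (x t) (y t)) _ _ fun z => ?_)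
  have h1 : relType r x (fun t => φ (x t) (y t) (z t)) = relType r z y :=
    Finset.sum_congr rfl fun t _ => by rw [(hφ _ _ _).1]
  have h2 : relType r (fun t => φ (x t) (y t) (z t)) y = relType r x z :=
    Finset.sum_congr rfl fun t _ => by rw [(hφ _ _ _).2]
  change _ = typeMat n r β x (fun t => φ (x t) (y t) (z t)) *
    typeMat n r α (fun t => φ (x t) (y t) (z t)) y
  rw [typeMat_apply, typeMat_apply, typeMat_apply, typeMat_apply, h1, h2, mul_comm]

lemma exists_typeMat_transpose {r : X → X → Fin (ℓ + 1)} {s : Fin (ℓ + 1) → Fin (ℓ + 1)}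
    (hs : ∀ x y, r y x = s (r x y)) {α : Fin ℓ → ℕ} (hα : α ∈ extD ℓ n) :
    ∃ β ∈ extD ℓ n, (typeMat n r α)ᵀ = typeMat n r β := by
  have hdet : ∀ x y x' y' : Fin n → X, relType r x y = relType r x' y' →
      relType r y x = relType r y' x' := by
    have hform : ∀ x y : Fin n → X, relType r y x =
        ∑ k, fullType n (relType r x y) k • relExp (s k) := by
      intro x y
      simp only [← card_filter_eq_fullType]
      simp only [relType, hs (x _) (y _)]
      rw [← Finset.sum_fiberwise' Finset.univ (fun t => r (x t) (y t))
        (fun k => relExp (s k))]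
      simp
    intro x y x' y' h
    rw [hform x y, hform x' y', h]
  by_cases h : ∃ x y : Fin n → X, relType r x y = α
  · obtain ⟨x, y, rfl⟩ := h
    refine ⟨relType r y x, mem_extD.mpr (sum_relType_le r y x), ?_⟩
    ext a b
    simp only [Matrix.transpose_apply, typeMat_apply]
    congr 1
    exact propext ⟨hdet _ _ _ _, hdet _ _ _ _⟩
  · refine ⟨α, hα, ?_⟩
    ext a b
    rw [Matrix.transpose_apply, typeMat_apply, typeMat_apply, if_neg, if_neg] <;>
      exact fun he => h ⟨_, _, he⟩

end RelationType

section ExtensionScheme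

variable {X : Type*} [Fintype X] [DecidableEq X] {ℓ n : ℕ}

lemma mul_mem_span_typeMat {r : X → X → Fin (ℓ + 1)}
    (hr : ∀ a b, r a b = 0 ↔ a = b) (hP : HasIntersectionNumbers r)
    (hcomm : ∀ α β, Commute (typeMat n r α) (typeMat n r β)) (α β : Fin ℓ → ℕ) :
    ∃ c : (Fin ℓ → ℕ) → ℂ,
      typeMat n r α * typeMat n r β = ∑ γ ∈ extD ℓ n, c γ • typeMat n r γ := by
  set S : Submodule ℂ (Matrix (Fin n → X) (Fin n → X) ℂ) :=
    Submodule.span ℂ (Set.range (typeMat n r)) with hS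
  have hmem : ∀ γ, typeMat n r γ ∈ S := fun γ => Submodule.subset_span ⟨γ, rfl⟩
  have heps : ∀ i, S ≤ S.comap (LinearMap.mulLeft ℂ (typeMat n r (epsV i))) := by
    intro i
    refine Submodule.span_le.mpr ?_
    rintro _ ⟨γ, rfl⟩
    have h := add_mem (Submodule.span_mono (Set.image_subset_range _ _)
      (typeMat_epsV_mul_mem (n := n) hr hP i γ))
      (S.smul_mem ((γ i : ℂ) + 1) (hmem (γ + epsV i)))
    simpa using h
  set M : Fin ℓ → Matrix (Fin n → X) (Fin n → X) ℂ := fun i => typeMat n r (epsV i) with hM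
  have hmono : ∀ γ, mpow M γ * typeMat n r β ∈ S := by
    intro γ
    induction hd : ∑ i, γ i generalizing γ with
    | zero =>
      have : γ = 0 := by
        ext i
        exact Finset.sum_eq_zero_iff.mp hd i (Finset.mem_univ i)
      rw [this, mpow_zero, one_mul]
      exact hmem β
    | succ d ih =>
      have hne : γ ≠ 0 := by
        rintro rfl
        simp at hd
      obtain ⟨i, δ, rfl⟩ := exists_eq_add_epsV hne
      rw [sum_add_epsV] at hd
      rw [mpow_add_epsV M (fun _ _ => hcomm _ _), mul_assoc]
      exact heps i (ih δ (by omega))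
  have hspan : ∀ d, mpowSpan M d ≤ S.comap (LinearMap.mulRight ℂ (typeMat n r β)) := by
    intro d
    refine Submodule.span_le.mpr ?_
    rintro _ ⟨γ, -, rfl⟩
    exact hmono γ
  obtain ⟨c, -, hc⟩ := exists_sub_smul_mpow_mem (typeMat n r) (typeMat_zero hr)
    (fun i j => hcomm _ _) (typeMat_epsV_mul_mem hr hP) α
  have hαβ : typeMat n r α * typeMat n r β ∈ S := by
    have h : (typeMat n r α - c • mpow M α) * typeMat n r β ∈ S := hspan _ hc
    have h' := add_mem h (S.smul_mem c (hmono α))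
    simpa [sub_mul] using h'
  have hdep : ∀ B ∈ S, ∃ f : (Fin ℓ → ℕ) → ℂ,
      B = Matrix.of fun x y : Fin n → X => f (relType r x y) := by
    intro B hB
    induction hB using Submodule.span_induction with
    | mem B hB =>
      obtain ⟨γ, rfl⟩ := hB
      exact ⟨fun δ => if δ = γ then 1 else 0, rfl⟩
    | zero => exact ⟨0, rfl⟩
    | add B C _ _ ihB ihC =>
      obtain ⟨f, rfl⟩ := ihB
      obtain ⟨g, rfl⟩ := ihC
      exact ⟨f + g, rfl⟩
    | smul a B _ ih =>
      obtain ⟨f, rfl⟩ := ih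
      exact ⟨a • f, rfl⟩
  obtain ⟨f, hf⟩ := hdep _ hαβ
  exact ⟨f, by rw [hf, of_relType_eq_sum]⟩

lemma isAssocScheme_typeMat {r : X → X → Fin (ℓ + 1)}
    (hr : ∀ a b, r a b = 0 ↔ a = b) (hP : HasIntersectionNumbers r)
    (hcomm : ∀ α β, Commute (typeMat n r α) (typeMat n r β))
    {s : Fin (ℓ + 1) → Fin (ℓ + 1)} (hs : ∀ x y, r y x = s (r x y)) :
    IsAssocScheme fun α : {a // a ∈ extD ℓ n} => typeMat n r α.1 where
  entries_zero_one α x y := by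
    rw [typeMat_apply]
    split_ifs <;> simp
  sum_eq_J := by
    rw [Finset.sum_coe_sort (extD ℓ n) (typeMat n r)]
    have h := of_relType_eq_sum (n := n) r (fun _ => 1)
    simp only [one_smul] at h
    exact h.symm
  exists_id := ⟨⟨0, mem_extD.mpr (by simp)⟩, typeMat_zero hr⟩
  exists_transpose α := by
    obtain ⟨β, hβ, h⟩ := exists_typeMat_transpose hs α.2
    exact ⟨⟨β, hβ⟩, h⟩
  mul_eq_lin α β := by
    obtain ⟨c, hc⟩ := mul_mem_span_typeMat hr hP hcomm α.1 β.1
    refine ⟨fun γ => c γ.1, ?_⟩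
    rw [hc, Finset.sum_coe_sort (extD ℓ n) (fun γ => c γ • typeMat n r γ)]
  mul_comm' α β := hcomm α.1 β.1

lemma isMultiPPoly_typeMat (hn : 1 ≤ n) {r : X → X → Fin (ℓ + 1)}
    (hr : ∀ a b, r a b = 0 ↔ a = b) (hP : HasIntersectionNumbers r)
    (hcomm : ∀ α β, Commute (typeMat n r α) (typeMat n r β))
    {s : Fin (ℓ + 1) → Fin (ℓ + 1)} (hs : ∀ x y, r y x = s (r x y))
    (mo : MonOrder ℓ) (hmo : ∀ a b : Fin ℓ → ℕ, ∑ i, a i < ∑ i, b i → mo.le a b) :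
    IsMultiPPoly (extD ℓ n) mo (typeMat n r) := by
  have key := exists_sub_smul_mpow_mem (typeMat n r) (typeMat_zero hr)
    (fun i j => hcomm _ _) (typeMat_epsV_mul_mem hr hP)
  set M : Fin ℓ → Matrix (Fin n → X) (Fin n → X) ℂ := fun i => typeMat n r (epsV i) with hM
  refine ⟨isAssocScheme_typeMat hr hP hcomm hs, ?_, ?_, ?_, ?_⟩
  · intro i
    rwa [mem_extD, sum_epsV]
  · intro α hα β hβ
    rw [mem_extD] at hα ⊢
    exact (Finset.sum_le_sum fun i _ => hβ i).trans hα
  · intro α hα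
    have hα' := mem_extD.mp hα
    obtain ⟨c, hc, hmem⟩ := key α
    obtain ⟨b, hb, hb'⟩ := exists_coeff_of_mem_mpowSpan M
      (show ∑ i, α i ≤ n + 1 by omega) hmem
    have hbα : b α = 0 := by
      by_contra h
      exact lt_irrefl _ (hb' α h)
    obtain ⟨v, hv, hcoeff⟩ := exists_matEval_eq M (extD ℓ n) (b + Pi.single α c)
    refine ⟨v, ?_, ⟨?_, ?_⟩, ?_⟩
    · rw [hv]
      simp only [Pi.add_apply, add_smul, Finset.sum_add_distrib]
      rw [← hb, Finset.sum_eq_single_of_mem α hα (fun β _ hβ => by simp [hβ])]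
      simp
    · rw [hcoeff, show ⇑(toExp α) = α from rfl, if_pos hα]
      simpa [hbα] using hc
    · intro d hd
      rw [MvPolynomial.mem_support_iff, hcoeff] at hd
      by_cases h : ⇑d = α
      · rw [h]
        exact mo.le_refl α
      · refine hmo _ _ (hb' _ fun hbd => hd ?_)
        simp [h, hbd]
    · intro d hd
      rw [MvPolynomial.mem_support_iff, hcoeff] at hd
      by_contra h
      simp [h] at hd
  · intro i α hα
    change ∃ c : (Fin ℓ → ℕ) → ℂ, M i * mpow M α = ∑ β ∈ extD ℓ n, c β • mpow M β ∧ _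
    rw [← mpow_add_epsV M (fun _ _ => hcomm _ _)]
    by_cases h : α + epsV i ∈ extD ℓ n
    · refine ⟨Pi.single (α + epsV i) 1, ?_, ?_⟩
      · rw [Finset.sum_eq_single_of_mem _ h (fun β _ hβ => by simp [hβ])]
        simp
      · intro β _ hβ
        by_cases he : β = α + epsV i
        · rw [he]
          exact mo.le_refl _
        · simp [he] at hβ
    · rw [mem_extD, not_le] at h
      have hα' := mem_extD.mp hα
      have hsum := sum_add_epsV α i
      obtain ⟨c, hc, hmem⟩ := key (α + epsV i)
      rw [typeMat_eq_zero r h, zero_sub, neg_mem_iff, Submodule.smul_mem_iff _ hc] at hmem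
      obtain ⟨b, hb, hb'⟩ := exists_coeff_of_mem_mpowSpan M
        (show ∑ j, (α + epsV i) j ≤ n + 1 by omega) hmem
      exact ⟨b, hb, fun β _ hβ => hmo _ _ (hb' β hβ)⟩

lemma IsAssocScheme.exists_relation {A : ℕ → Matrix X X ℂ}
    (hA : IsAssocScheme fun i : Fin (ℓ + 1) => A i) :
    ∃ r : X → X → Fin (ℓ + 1), ∀ (i : Fin (ℓ + 1)) x y, A i x y = if r x y = i then 1 else 0 := by
  have hex : ∀ x y, ∃ k : Fin (ℓ + 1), ∀ i : Fin (ℓ + 1), A i x y = if k = i then 1 else 0 := by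
    intro x y
    have hsum : ∑ i : Fin (ℓ + 1), A i x y = 1 := by
      have h := congrFun (congrFun hA.sum_eq_J x) y
      rwa [Matrix.sum_apply] at h
    have hind : ∀ i : Fin (ℓ + 1), A i x y = if A i x y = 1 then 1 else 0 := by
      intro i
      have h : A i x y = 0 ∨ A i x y = 1 := hA.entries_zero_one i x y
      rcases h with h | h <;> simp [h]
    rw [Finset.sum_congr rfl fun i _ => hind i, Finset.sum_boole, Nat.cast_eq_one,
      Finset.card_eq_one] at hsum
    obtain ⟨k, hk⟩ := hsum
    refine ⟨k, fun i => ?_⟩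
    have hi : A i x y = 1 ↔ k = i := by
      have := Finset.ext_iff.mp hk i
      simpa [eq_comm] using this
    rw [hind i]
    simp only [hi]
  choose r hr using hex
  exact ⟨r, fun i x y => hr x y i⟩

end ExtensionScheme

lemma mul_apply_eq_card {X : Type*} [Fintype X] {ℓ : ℕ} {A : ℕ → Matrix X X ℂ}
    {r : X → X → Fin (ℓ + 1)}
    (hA : ∀ (i : Fin (ℓ + 1)) x y, A i x y = if r x y = i then 1 else 0)
    (i j : Fin (ℓ + 1)) (x y : X) :
    (A i * A j) x y = ((Finset.univ.filter fun w => r x w = i ∧ r w y = j).card : ℂ) := by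
  simp only [Matrix.mul_apply, hA, Finset.card_filter, ite_and, Nat.cast_sum]
  refine Finset.sum_congr rfl fun w _ => ?_
  split_ifs <;> simp

lemma extA_eq_typeMat {X : Type*} {ℓ n : ℕ} {A : ℕ → Matrix X X ℂ} {r : X → X → Fin (ℓ + 1)}
    (hA : ∀ (i : Fin (ℓ + 1)) x y, A i x y = if r x y = i then 1 else 0) :
    extA ℓ n A = typeMat n r := by
  ext α x y
  have hi : ∀ (i : Fin ℓ) x y, A ((i : ℕ) + 1) x y = 1 ↔ r x y = i.succ := by
    intro i x y
    have := hA i.succ x y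
    rw [Fin.val_succ] at this
    rw [this]
    simp
  simp only [extA, Matrix.of_apply, typeMat_apply, hi, funext_iff, relType_apply]

/-- Theorem 4.4 (P-part): the extension `S^n(𝔛)` of a commutative association scheme `𝔛` of
class `ℓ` is an `ℓ`-variate `P`-polynomial association scheme on `D = {α : |α| ≤ n}` with
respect to the graded lexicographic order. -/
theorem extension_isMultiPPoly {X : Type*} [Fintype X] [DecidableEq X] (ℓ n : ℕ)
    (hn : 1 ≤ n) (A : ℕ → Matrix X X ℂ)
    (hscheme : IsAssocScheme fun i : Fin (ℓ + 1) => A i)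
    (hA0 : A 0 = 1)
    (mo : MonOrder ℓ) (hmo : mo.le = fun a b => grlexLe a b) :
    IsMultiPPoly (extD ℓ n) mo (extA ℓ n A) := by
  obtain ⟨r, hA⟩ := hscheme.exists_relation
  have hr : ∀ a b, r a b = 0 ↔ a = b := by
    intro a b
    have h := hA 0 a b
    rw [Fin.val_zero, hA0, Matrix.one_apply] at h
    by_cases h1 : r a b = 0 <;> by_cases h2 : a = b <;> simp_all
  have hP : HasIntersectionNumbers r := by
    choose P hP using hscheme.mul_eq_lin
    refine ⟨P, fun i j x y => ?_⟩
    rw [← mul_apply_eq_card hA, hP i j]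
    simp [Matrix.sum_apply, hA]
  have hC : ∀ i j x y, (Finset.univ.filter fun w => r x w = i ∧ r w y = j).card =
      (Finset.univ.filter fun w => r x w = j ∧ r w y = i).card := by
    intro i j x y
    have h := congrFun (congrFun (hscheme.mul_comm' i j) x) y
    simp only [mul_apply_eq_card hA] at h
    exact_mod_cast h
  choose s hs using hscheme.exists_transpose
  have hs' : ∀ x y, r y x = s (r x y) := by
    intro x y
    have h := congrFun (congrFun (hs (r x y)) y) x
    rw [Matrix.transpose_apply, hA, hA, if_pos rfl] at h
    by_contra hne
    simp [hne] at h
  rw [extA_eq_typeMat hA]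
  refine isMultiPPoly_typeMat hn hr hP (fun α β => typeMat_mul_comm hC α β) hs' mo ?_
  intro a b h
  rw [hmo]
  exact Or.inl h
end
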